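/- Let (𝒳,d) be a metric space carrying a geodesic CAT(0) structure whose geodesic map is jointly Borel measurable, let (Ω,ℱ,P) be a probability space, and let X, Y, Z : Ω → 𝒳 be Borel random objects with E[d(x₀,X)²], E[d(x₀,Y)²], E[d(x₀,Z)²] < ∞ for some (hence every) x₀ ∈ 𝒳. Define ρ(U,V) := (E[d(U,V)²])^{1/2} and, for t ∈ [0,1], the pointwise geodesic W_t(ω) := [X(ω),Y(ω)]_t. Then for all s, t ∈ [0,1]: ρ(W_s,W_t) = |s−t|·ρ(X,Y), W_0 = X, W_1 = Y, and the CAT(0) inequality holds in L²: ρ(W_t,Z)² ≤ (1−t)·ρ(X,Z)² + t·ρ(Y,Z)² − t·(1−t)·ρ(X,Y)². -/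

import Mathlib

open MeasureTheory ProbabilityTheory Filter

/-- A geodesic CAT(0) structure on a metric space `X`: a geodesic selection
`γ x y t` (`t ∈ [0,1]`) with endpoints `x`, `y`, affinely parameterized,
satisfying the CAT(0) comparison inequality. -/
structure GeodesicCAT0 (X : Type*) [MetricSpace X] where
  γ : X → X → ℝ → X
  γ_zero : ∀ x y : X, γ x y 0 = x
  γ_one : ∀ x y : X, γ x y 1 = y
  dist_γ : ∀ x y : X, ∀ s ∈ Set.Icc (0:ℝ) 1, ∀ t ∈ Set.Icc (0:ℝ) 1,
    dist (γ x y s) (γ x y t) = |s - t| * dist x y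
  cat0 : ∀ x y z : X, ∀ t ∈ Set.Icc (0:ℝ) 1,
    dist (γ x y t) z ^ 2 ≤
      (1 - t) * dist x z ^ 2 + t * dist y z ^ 2 - t * (1 - t) * dist x y ^ 2

/-- Joint Borel measurability of the geodesic map of a `GeodesicCAT0` structure. -/
def GeodesicCAT0.MeasurableGeo {X : Type*} [MetricSpace X] [MeasurableSpace X]
    (G : GeodesicCAT0 X) : Prop :=
  Measurable fun p : X × X × ℝ => G.γ p.1 p.2.1 p.2.2

/-- `θ` is a Fréchet mean of the Borel random object `f` (defined on a probability
space `(Ω, P)`, taking values in a metric space): it minimizes `z ↦ E[d(z, f)²]`. -/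
def IsFrechetMeanRV {Ω X : Type*} [MetricSpace X] [MeasurableSpace Ω]
    (P : Measure Ω) (f : Ω → X) (θ : X) : Prop :=
  ∀ z : X, ∫ ω, dist θ (f ω) ^ 2 ∂P ≤ ∫ ω, dist z (f ω) ^ 2 ∂P

/-- `θ` is a Fréchet mean of the Borel probability measure `P` on a metric space:
it minimizes `z ↦ ∫ d(z,u)² dP(u)`. -/
def IsFrechetMean {X : Type*} [MetricSpace X] [MeasurableSpace X]
    (P : Measure X) (θ : X) : Prop :=
  ∀ z : X, ∫ u, dist θ u ^ 2 ∂P ≤ ∫ u, dist z u ^ 2 ∂P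

/-- The James–Stein shrinkage weight `w = min(1, σ²/dsq)` as a function of the squared
distance `dsq` to the shrinkage point, with `w = 1` when `dsq = 0`. -/
noncomputable def jsWeight (σsq dsq : ℝ) : ℝ :=
  if dsq = 0 then 1 else min 1 (σsq / dsq)

/-- The `L²` pseudo-distance between two random objects in a metric space. -/
noncomputable def rhoL2 {Ω X : Type*} [MetricSpace X] [MeasurableSpace Ω]
    (P : Measure Ω) (U V : Ω → X) : ℝ :=
  Real.sqrt (∫ ω, dist (U ω) (V ω) ^ 2 ∂P)

namespace GeodesicCAT0

variable {X : Type*} [MetricSpace X] (G : GeodesicCAT0 X)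

lemma dist_left_γ (x y : X) {t : ℝ} (ht : t ∈ Set.Icc (0:ℝ) 1) :
    dist x (G.γ x y t) = t * dist x y := by
  have h := G.dist_γ x y 0 (by simp) t ht
  rwa [G.γ_zero, zero_sub, abs_neg, abs_of_nonneg ht.1] at h

lemma dist_γ_right (x y : X) {t : ℝ} (ht : t ∈ Set.Icc (0:ℝ) 1) :
    dist (G.γ x y t) y = (1 - t) * dist x y := by
  have h := G.dist_γ x y t ht 1 (by simp)
  rwa [G.γ_one, abs_sub_comm, abs_of_nonneg (sub_nonneg.2 ht.2)] at h

lemma eq_γ_of_dist {x y z : X} {t : ℝ} (ht : t ∈ Set.Icc (0:ℝ) 1)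
    (hx : dist x z = t * dist x y) (hy : dist z y = (1 - t) * dist x y) :
    z = G.γ x y t := by
  have h := G.cat0 x y z t ht
  rw [hx, dist_comm y z, hy] at h
  have h0 : dist (G.γ x y t) z ^ 2 ≤ 0 := h.trans_eq (by ring)
  exact (dist_eq_zero.1 (pow_eq_zero_iff two_ne_zero |>.1
    (le_antisymm h0 (sq_nonneg _)))).symm

/-- A subsegment ending at the terminal point of a geodesic is the geodesic. -/
lemma γ_γ_right (x y : X) {u η : ℝ} (hu : u ∈ Set.Icc (0:ℝ) 1) (hη : η ∈ Set.Icc (0:ℝ) 1) :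
    G.γ x y (u + η * (1 - u)) = G.γ (G.γ x y u) y η := by
  have hu' : u + η * (1 - u) ∈ Set.Icc (0:ℝ) 1 :=
    ⟨by nlinarith [hu.1, hu.2, hη.1, hη.2], by nlinarith [hu.1, hu.2, hη.1, hη.2]⟩
  apply G.eq_γ_of_dist hη
  · rw [G.dist_γ x y u hu _ hu', G.dist_γ_right x y hu, abs_sub_comm, add_sub_cancel_left,
      abs_of_nonneg (mul_nonneg hη.1 (sub_nonneg.2 hu.2))]
    ring
  · rw [G.dist_γ_right x y hu', G.dist_γ_right x y hu]
    ring

lemma dist_sq_γ_le (o p q : X) {τ η : ℝ} (hτ : τ ∈ Set.Icc (0:ℝ) 1)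
    (hη : η ∈ Set.Icc (0:ℝ) 1) :
    τ * dist (G.γ p o η) q ^ 2 ≤ τ * dist p q ^ 2
      - η * (dist p o ^ 2 - dist (G.γ p q τ) o ^ 2) + η ^ 2 * dist p o ^ 2 := by
  have h1 := G.cat0 p o (G.γ p q τ) η hη
  rw [G.dist_left_γ p q hτ, dist_comm o (G.γ p q τ)] at h1
  have h2 := dist_triangle (G.γ p o η) (G.γ p q τ) q
  rw [G.dist_γ_right p q hτ] at h2
  set D := dist (G.γ p o η) (G.γ p q τ)
  have h3 : dist (G.γ p o η) q ^ 2 ≤ (D + (1 - τ) * dist p q) ^ 2 :=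
    pow_le_pow_left₀ dist_nonneg h2 2
  have h4 := mul_le_mul_of_nonneg_left h3 hτ.1
  have h5 : 0 ≤ (1 - τ) * (D - τ * dist p q) ^ 2 :=
    mul_nonneg (sub_nonneg.2 hτ.2) (sq_nonneg _)
  have h6 : 0 ≤ η * (τ ^ 2 * dist p q ^ 2) := mul_nonneg hη.1 (by positivity)
  nlinarith

lemma dist_sq_sub_le (o p q : X) {τ η : ℝ} (hτ : τ ∈ Set.Icc (0:ℝ) 1)
    (hη : η ∈ Set.Icc (0:ℝ) 1) :
    τ * (dist p q ^ 2 - dist (G.γ p o η) q ^ 2) ≤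
      η * (dist p o ^ 2 - dist (G.γ p q τ) o ^ 2) + τ ^ 2 * dist p q ^ 2 := by
  have h1 := G.cat0 p q (G.γ p o η) τ hτ
  rw [G.dist_left_γ p o hη, dist_comm q (G.γ p o η)] at h1
  have h2 := dist_triangle (G.γ p q τ) (G.γ p o η) o
  rw [G.dist_γ_right p o hη] at h2
  set D := dist (G.γ p q τ) (G.γ p o η)
  have h3 : dist (G.γ p q τ) o ^ 2 ≤ (D + (1 - η) * dist p o) ^ 2 :=
    pow_le_pow_left₀ dist_nonneg h2 2
  have h4 := mul_le_mul_of_nonneg_left h3 hη.1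
  have h5 : 0 ≤ (1 - η) * (D - η * dist p o) ^ 2 :=
    mul_nonneg (sub_nonneg.2 hη.2) (sq_nonneg _)
  have h6 : 0 ≤ τ * (η ^ 2 * dist p o ^ 2) := mul_nonneg hτ.1 (by positivity)
  nlinarith

/-- Difference quotients of minus the squared distance to `o` along the geodesic from `p`
to `q`. -/
noncomputable def sqQuot (o p q : X) (n : ℕ) : ℝ :=
  (dist p o ^ 2 - dist (G.γ p q (1 / ((n : ℝ) + 1))) o ^ 2) * ((n : ℝ) + 1)

/-- The initial rate of decrease of the squared distance to `o` along the geodesic from `p`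
to `q`. -/
noncomputable def sqSlope (o p q : X) : ℝ := ⨆ n, G.sqQuot o p q n

lemma one_div_mem_Icc (n : ℕ) : 1 / ((n : ℝ) + 1) ∈ Set.Icc (0:ℝ) 1 :=
  ⟨by positivity, by rw [div_le_one (by positivity)]; linarith [n.cast_nonneg (α := ℝ)]⟩

lemma mul_sqQuot (o p q : X) (n : ℕ) :
    1 / ((n : ℝ) + 1) * G.sqQuot o p q n =
      dist p o ^ 2 - dist (G.γ p q (1 / ((n : ℝ) + 1))) o ^ 2 := by
  have : (n : ℝ) + 1 ≠ 0 := by positivity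
  unfold sqQuot
  field_simp

lemma sqQuot_le (o p q : X) (n : ℕ) : G.sqQuot o p q n ≤ 2 * dist p o * dist p q := by
  have hτ := one_div_mem_Icc n
  have hpos : 0 < 1 / ((n : ℝ) + 1) := by positivity
  have h := G.mul_sqQuot o p q n
  have h1 := dist_triangle p (G.γ p q (1 / ((n : ℝ) + 1))) o
  rw [G.dist_left_γ p q hτ] at h1
  set τ := 1 / ((n : ℝ) + 1)
  refine le_of_mul_le_mul_left ?_ hpos
  rw [h]
  have h2 : 0 ≤ dist p o := dist_nonneg
  have h3 : 0 ≤ dist (G.γ p q τ) o := dist_nonneg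
  have h4 : 0 ≤ τ * dist p q := mul_nonneg hτ.1 dist_nonneg
  rcases le_total (dist p o) (dist (G.γ p q τ) o) with h5 | h5
  · nlinarith [mul_nonneg h2 h4]
  · nlinarith [mul_nonneg h2 h4]

lemma bddAbove_sqQuot (o p q : X) : BddAbove (Set.range (G.sqQuot o p q)) :=
  ⟨_, Set.forall_mem_range.2 (G.sqQuot_le o p q)⟩

lemma sqSlope_le (o p q : X) : G.sqSlope o p q ≤ 2 * dist p o * dist p q :=
  ciSup_le (G.sqQuot_le o p q)

lemma dist_sq_sub_le_sqSlope (o p q : X) {η : ℝ} (hη : η ∈ Set.Icc (0:ℝ) 1) :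
    dist p q ^ 2 - dist (G.γ p o η) q ^ 2 ≤ η * G.sqSlope o p q := by
  have key (n : ℕ) : dist p q ^ 2 - dist (G.γ p o η) q ^ 2 ≤
      η * G.sqSlope o p q + 1 / ((n : ℝ) + 1) * dist p q ^ 2 := by
    have hpos : 0 < 1 / ((n : ℝ) + 1) := by positivity
    have h := G.dist_sq_sub_le o p q (one_div_mem_Icc n) hη
    rw [← G.mul_sqQuot] at h
    have h1 := mul_le_mul_of_nonneg_left (le_ciSup (G.bddAbove_sqQuot o p q) n) hη.1
    change η * G.sqQuot o p q n ≤ η * G.sqSlope o p q at h1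
    have h2 := mul_le_mul_of_nonneg_left h1 hpos.le
    refine le_of_mul_le_mul_left ?_ hpos
    nlinarith
  have hlim : Tendsto (fun n : ℕ => η * G.sqSlope o p q + 1 / ((n : ℝ) + 1) * dist p q ^ 2)
      atTop (nhds (η * G.sqSlope o p q + 0 * dist p q ^ 2)) :=
    (tendsto_one_div_add_atTop_nhds_zero_nat.mul_const _).const_add _
  rw [zero_mul, add_zero] at hlim
  exact ge_of_tendsto' hlim key

lemma dist_sq_γ_le_sqQuot (o p q : X) {η : ℝ} (hη : η ∈ Set.Icc (0:ℝ) 1) (n : ℕ) :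
    dist (G.γ p o η) q ^ 2 ≤ dist p q ^ 2 - η * G.sqQuot o p q n
      + η ^ 2 * (((n : ℝ) + 1) * dist p o ^ 2) := by
  have hpos : 0 < 1 / ((n : ℝ) + 1) := by positivity
  have h := G.dist_sq_γ_le o p q (one_div_mem_Icc n) hη
  rw [← G.mul_sqQuot] at h
  refine le_of_mul_le_mul_left (h.trans_eq ?_) hpos
  have : (n : ℝ) + 1 ≠ 0 := by positivity
  field_simp

lemma neg_le_sqSlope (o p q : X) : -(2 * dist p o * dist o q) ≤ G.sqSlope o p q := by
  have h := G.dist_sq_sub_le_sqSlope o p q (η := 1) (by simp)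
  rw [G.γ_one, one_mul] at h
  refine le_trans ?_ h
  have h1 := dist_triangle o p q
  rw [dist_comm o p] at h1
  have h2 : 0 ≤ dist p o := dist_nonneg
  have h3 : 0 ≤ dist o q := dist_nonneg
  have h4 : 0 ≤ dist p q := dist_nonneg
  rcases le_total (dist o q) (dist p q) with h5 | h5 <;> nlinarith [mul_nonneg h2 h3]

/-- First variation formula for the squared distance to `q` along the geodesic from `x`
to `o`. -/
lemma hasDerivWithinAt_dist_sq (o x q : X) {u : ℝ} (hu : u ∈ Set.Ioo (0:ℝ) 1) :
    HasDerivWithinAt (fun v => dist (G.γ x o v) q ^ 2)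
      (-(G.sqSlope o (G.γ x o u) q / (1 - u))) (Set.Ioi u) u := by
  have hu' : u ∈ Set.Icc (0:ℝ) 1 := Set.Ioo_subset_Icc_self hu
  have h1u : 0 < 1 - u := sub_pos.2 hu.2
  set p := G.γ x o u with hp
  have hpt {v : ℝ} (hv : v ∈ Set.Ioo u 1) : (v - u) / (1 - u) ∈ Set.Icc (0:ℝ) 1 ∧
      G.γ x o v = G.γ p o ((v - u) / (1 - u)) := by
    have hη : (v - u) / (1 - u) ∈ Set.Icc (0:ℝ) 1 :=
      ⟨div_nonneg (sub_nonneg.2 hv.1.le) h1u.le, by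
        rw [div_le_one h1u]; linarith [hv.2]⟩
    refine ⟨hη, ?_⟩
    rw [hp, ← G.γ_γ_right x o hu' hη, div_mul_cancel₀ _ h1u.ne', add_sub_cancel]
  rw [hasDerivWithinAt_iff_tendsto_slope' (by simp), Metric.tendsto_nhds]
  intro ε hε
  obtain ⟨n, hn⟩ := exists_lt_of_lt_ciSup
    (show G.sqSlope o p q - ε * (1 - u) / 2 < ⨆ n, G.sqQuot o p q n by
      change _ < G.sqSlope o p q
      linarith [mul_pos hε h1u])
  set C := ((n : ℝ) + 1) * dist p o ^ 2 with hC
  have hC0 : 0 ≤ C := by positivity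
  have hev : ∀ᶠ v in nhdsWithin u (Set.Ioi u), (v - u) / (1 - u) * C < ε * (1 - u) / 2 := by
    apply Filter.Tendsto.eventually_lt_const (u := ε * (1 - u) / 2) (v := 0) (by positivity)
    have : Continuous fun v : ℝ => (v - u) / (1 - u) * C := by fun_prop
    simpa using (this.tendsto u).mono_left nhdsWithin_le_nhds
  filter_upwards [hev, Ioo_mem_nhdsGT hu.2] with v hvC hv
  obtain ⟨hη, hγ⟩ := hpt hv
  have hvu : 0 < v - u := sub_pos.2 hv.1
  have hup := G.dist_sq_sub_le_sqSlope o p q hη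
  have hlo := G.dist_sq_γ_le_sqQuot o p q hη n
  rw [← hγ] at hup hlo
  have hη0 : 0 < (v - u) / (1 - u) := div_pos hvu h1u
  set η := (v - u) / (1 - u) with hηdef
  have hvη : v - u = η * (1 - u) := by rw [hηdef, div_mul_cancel₀ _ h1u.ne']
  have hgap : dist (G.γ x o v) q ^ 2 - dist p q ^ 2 + η * G.sqSlope o p q
      < ε * (η * (1 - u)) := by
    have e1 := mul_lt_mul_of_pos_left hn hη0
    have e2 := mul_lt_mul_of_pos_left hvC hη0
    nlinarith
  rw [slope_def_field, Real.dist_eq, ← hp,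
    show (dist (G.γ x o v) q ^ 2 - dist p q ^ 2) / (v - u) - -(G.sqSlope o p q / (1 - u))
      = (dist (G.γ x o v) q ^ 2 - dist p q ^ 2 + η * G.sqSlope o p q) / (η * (1 - u)) by
      rw [hvη]; field_simp; ring,
    abs_of_nonneg (div_nonneg (by linarith) (by positivity)), div_lt_iff₀ (by positivity)]
  exact hgap

lemma continuousOn_γ (x y : X) : ContinuousOn (G.γ x y) (Set.Icc 0 1) := by
  refine (LipschitzOnWith.of_dist_le_mul (K := nndist x y) fun s hs t ht => ?_).continuousOn
  rw [G.dist_γ x y s hs t ht, Real.dist_eq, coe_nndist, mul_comm]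

variable [MeasurableSpace X]

variable {G} in
lemma MeasurableGeo.comp (hG : G.MeasurableGeo) {α : Type*} [MeasurableSpace α]
    {f g : α → X} {t : α → ℝ} (hf : Measurable f) (hg : Measurable g) (ht : Measurable t) :
    Measurable fun a => G.γ (f a) (g a) (t a) :=
  Measurable.comp (g := fun p : X × X × ℝ => G.γ p.1 p.2.1 p.2.2) hG
    (hf.prodMk (hg.prodMk ht))

variable [BorelSpace X]

variable {G} in
lemma MeasurableGeo.sqSlope (hG : G.MeasurableGeo) {α : Type*} [MeasurableSpace α]
    {f g : α → X} (hf : Measurable f) (hg : Measurable g) (o : X) :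
    Measurable fun a => G.sqSlope o (f a) (g a) := by
  have hd {h : α → X} (hh : Measurable h) : Measurable fun a => dist (h a) o :=
    (continuous_id.dist continuous_const).measurable.comp hh
  exact Measurable.iSup fun n => (((hd hf).pow_const 2).sub
    ((hd (hG.comp hf hg measurable_const)).pow_const 2)).mul_const _

variable {G} in
lemma MeasurableGeo.dist_sq_eq (hG : G.MeasurableGeo) (o x y : X) :
    dist x y ^ 2 = dist o y ^ 2 +
      ∫ u in (0:ℝ)..1, G.sqSlope o (G.γ x o u) y / (1 - u) := by
  have hmeas : Measurable fun u : ℝ => G.sqSlope o (G.γ x o u) y / (1 - u) :=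
    (hG.sqSlope (hG.comp measurable_const measurable_const measurable_id)
      measurable_const o).div (measurable_const.sub measurable_id)
  have hbd : ∀ u ∈ Set.Ioc (0:ℝ) 1, ‖G.sqSlope o (G.γ x o u) y / (1 - u)‖ ≤
      2 * dist x o * (dist x o + dist o y) := by
    intro u hu
    have hK : 0 ≤ 2 * dist x o * (dist x o + dist o y) := by positivity
    rcases hu.2.eq_or_lt with rfl | hu1
    · simpa using hK
    have h1u : 0 < 1 - u := sub_pos.2 hu1
    have hp := G.dist_γ_right x o ⟨hu.1.le, hu.2⟩
    have h1 := G.sqSlope_le o (G.γ x o u) y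
    have h2 := G.neg_le_sqSlope o (G.γ x o u) y
    have h3 := dist_triangle (G.γ x o u) o y
    have hx : 0 ≤ dist x o := dist_nonneg
    have hy : 0 ≤ dist o y := dist_nonneg
    rw [hp] at h1 h2 h3
    have h4 : dist (G.γ x o u) y ≤ dist x o + dist o y := by nlinarith [hu.1]
    have h5 : 0 ≤ (1 - u) * dist x o := mul_nonneg h1u.le hx
    rw [Real.norm_eq_abs, abs_div, abs_of_pos h1u, div_le_iff₀ h1u, abs_le]
    constructor <;> nlinarith [mul_le_mul_of_nonneg_left h4 h5, mul_nonneg h5 hx]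
  have h_int : IntervalIntegrable (fun u : ℝ => G.sqSlope o (G.γ x o u) y / (1 - u))
      volume 0 1 := by
    rw [intervalIntegrable_iff_integrableOn_Ioc_of_le zero_le_one]
    exact Measure.integrableOn_of_bounded (by simp) hmeas.aestronglyMeasurable
      ((ae_restrict_iff' measurableSet_Ioc).2 (ae_of_all _ hbd))
  have hcont : ContinuousOn (fun v => dist (G.γ x o v) y ^ 2) (Set.Icc 0 1) :=
    ((continuous_id.dist continuous_const).comp_continuousOn (G.continuousOn_γ x o)).pow 2
  have h := intervalIntegral.integral_eq_sub_of_hasDeriv_right_of_le zero_le_one hcont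
    (fun u hu => G.hasDerivWithinAt_dist_sq o x y hu) h_int.neg
  rw [intervalIntegral.integral_neg, G.γ_zero, G.γ_one] at h
  linarith

/-- If the geodesic map is measurable for the product `σ`-algebra, then so is the distance,
even when the space is not separable. -/
theorem MeasurableGeo.measurable_dist {G : GeodesicCAT0 X} (hG : G.MeasurableGeo) {α : Type*}
    [MeasurableSpace α] {f g : α → X} (hf : Measurable f) (hg : Measurable g) :
    Measurable fun a => dist (f a) (g a) := by
  rcases isEmpty_or_nonempty α with hα | ⟨⟨a₀⟩⟩
  · exact measurable_of_empty _
  set o := f a₀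
  have hsq : Measurable fun a => dist (f a) (g a) ^ 2 := by
    have ho : Measurable fun a => dist o (g a) :=
      (continuous_const.dist continuous_id).measurable.comp hg
    have hF : Measurable fun p : α × ℝ =>
        G.sqSlope o (G.γ (f p.1) o p.2) (g p.1) / (1 - p.2) :=
      (hG.sqSlope (hG.comp (hf.comp measurable_fst) measurable_const measurable_snd)
        (hg.comp measurable_fst) o).div (measurable_const.sub measurable_snd)
    have h_int := (hF.stronglyMeasurable.integral_prod_right'
      (ν := volume.restrict (Set.Ioc (0:ℝ) 1))).measurable
    convert (ho.pow_const 2).add h_int using 1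
    ext a
    rw [hG.dist_sq_eq o, intervalIntegral.integral_of_le zero_le_one]
    rfl
  simpa [Real.sqrt_sq dist_nonneg] using hsq.sqrt

lemma MeasurableGeo.integrable_dist_sq {G : GeodesicCAT0 X} (hG : G.MeasurableGeo)
    {Ω : Type*} [MeasurableSpace Ω] {P : Measure Ω} {U V : Ω → X} (hU : Measurable U)
    (hV : Measurable V) {o : X} (hiU : Integrable (fun ω => dist o (U ω) ^ 2) P)
    (hiV : Integrable (fun ω => dist o (V ω) ^ 2) P) :
    Integrable (fun ω => dist (U ω) (V ω) ^ 2) P := by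
  refine ((hiU.const_mul 2).add (hiV.const_mul 2)).mono'
    ((hG.measurable_dist hU hV).pow_const 2).aestronglyMeasurable (ae_of_all _ fun ω => ?_)
  have h := dist_triangle_left (U ω) (V ω) o
  rw [Real.norm_of_nonneg (sq_nonneg _), Pi.add_apply]
  nlinarith [sq_nonneg (dist o (U ω) - dist o (V ω)),
    pow_le_pow_left₀ dist_nonneg h 2]

end GeodesicCAT0

lemma rhoL2_sq {Ω X : Type*} [MetricSpace X] [MeasurableSpace Ω] (P : Measure Ω)
    (U V : Ω → X) : rhoL2 P U V ^ 2 = ∫ ω, dist (U ω) (V ω) ^ 2 ∂P :=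
  Real.sq_sqrt (integral_nonneg fun _ => sq_nonneg _)

/-- the space of square-integrable random objects with the `L²` distance
`ρ` inherits pointwise geodesics and the CAT(0) inequality from `X`. -/
theorem L2_inherits_cat0 {X : Type*} [MetricSpace X] [MeasurableSpace X] [BorelSpace X]
    (G : GeodesicCAT0 X) (hG : G.MeasurableGeo)
    {Ω : Type*} [MeasurableSpace Ω] (P : Measure Ω) [IsProbabilityMeasure P]
    (Xr Yr Zr : Ω → X) (hX : Measurable Xr) (hY : Measurable Yr) (hZ : Measurable Zr)
    (hiX : ∀ x₀ : X, Integrable (fun ω => dist x₀ (Xr ω) ^ 2) P)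
    (hiY : ∀ x₀ : X, Integrable (fun ω => dist x₀ (Yr ω) ^ 2) P)
    (hiZ : ∀ x₀ : X, Integrable (fun ω => dist x₀ (Zr ω) ^ 2) P) :
    (∀ s ∈ Set.Icc (0:ℝ) 1, ∀ t ∈ Set.Icc (0:ℝ) 1,
      rhoL2 P (fun ω => G.γ (Xr ω) (Yr ω) s) (fun ω => G.γ (Xr ω) (Yr ω) t)
        = |s - t| * rhoL2 P Xr Yr) ∧
    (∀ ω, G.γ (Xr ω) (Yr ω) 0 = Xr ω) ∧
    (∀ ω, G.γ (Xr ω) (Yr ω) 1 = Yr ω) ∧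
    (∀ t ∈ Set.Icc (0:ℝ) 1,
      rhoL2 P (fun ω => G.γ (Xr ω) (Yr ω) t) Zr ^ 2 ≤
        (1 - t) * rhoL2 P Xr Zr ^ 2 + t * rhoL2 P Yr Zr ^ 2
          - t * (1 - t) * rhoL2 P Xr Yr ^ 2) := by
  refine ⟨fun s hs t ht => ?_, fun ω => G.γ_zero _ _, fun ω => G.γ_one _ _, fun t ht => ?_⟩
  · simp only [rhoL2, G.dist_γ _ _ s hs t ht, mul_pow, integral_const_mul]
    rw [Real.sqrt_mul (sq_nonneg _), Real.sqrt_sq (abs_nonneg _)]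
  · obtain ⟨ω₀⟩ : Nonempty Ω := nonempty_of_isProbabilityMeasure P
    have hXZ := hG.integrable_dist_sq hX hZ (hiX (Xr ω₀)) (hiZ (Xr ω₀))
    have hYZ := hG.integrable_dist_sq hY hZ (hiY (Xr ω₀)) (hiZ (Xr ω₀))
    have hXY := hG.integrable_dist_sq hX hY (hiX (Xr ω₀)) (hiY (Xr ω₀))
    have hsum : Integrable (fun ω => (1 - t) * dist (Xr ω) (Zr ω) ^ 2
        + t * dist (Yr ω) (Zr ω) ^ 2) P := (hXZ.const_mul (1 - t)).add (hYZ.const_mul t)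
    simp only [rhoL2_sq]
    rw [← integral_const_mul, ← integral_const_mul, ← integral_const_mul,
      ← integral_add (hXZ.const_mul _) (hYZ.const_mul _),
      ← integral_sub hsum (hXY.const_mul _)]
    exact integral_mono_of_nonneg (ae_of_all _ fun ω => sq_nonneg _)
      (hsum.sub (hXY.const_mul _)) (ae_of_all _ fun ω => G.cat0 _ _ _ t ht)
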